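/- The map K ↦ (supp(K), sgn(K)) restricts to a bijection between the set of maximal chains of the poset E(P) and the set of pairs (C, φ) where C is a maximal chain of order filters of P and φ : P → {1,-1} is an arbitrary map. -/

import Mathlib

open Classical

/-- An order filter (upper set) of a poset. -/
def IsOrderFilter {P : Type*} [PartialOrder P] (F : Set P) : Prop :=
  ∀ ⦃u v : P⦄, u ∈ F → u ≤ v → v ∈ F

/-- The support of an integer-valued map. -/
def zsupp {P : Type*} (f : P → ℤ) : Set P := {v | f v ≠ 0}

/-- Membership in `E(P)`. -/
def IsEF {P : Type*} [PartialOrder P] (f : P → ℤ) : Prop :=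
  (∀ v, f v = 1 ∨ f v = 0 ∨ f v = -1) ∧
  IsOrderFilter (zsupp f) ∧
  ∀ v ∈ zsupp f, ¬ Minimal (· ∈ zsupp f) v → f v = 1

/-- The strict relation `f > g` on `E(P)`. -/
def egt {P : Type*} [PartialOrder P] (f g : P → ℤ) : Prop :=
  zsupp g ⊂ zsupp f ∧
  (∀ v ∈ zsupp g, g v ≤ f v) ∧
  ∀ v ∈ zsupp g, Minimal (· ∈ zsupp f) v → f v = g v

/-- The relation `f ≥ g` on `E(P)`. -/
def ege {P : Type*} [PartialOrder P] (f g : P → ℤ) : Prop := f = g ∨ egt f g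

/-- A chain in the poset `E(P)`. -/
def IsEChain {P : Type*} [PartialOrder P] (K : Set (P → ℤ)) : Prop :=
  (∀ f ∈ K, IsEF f) ∧ IsChain ege K

/-- A maximal chain in the poset `E(P)`. -/
def IsMaxEChain {P : Type*} [PartialOrder P] (K : Set (P → ℤ)) : Prop :=
  IsEChain K ∧ ∀ L, IsEChain L → K ⊆ L → K = L

/-- The set of minimal elements of a subset. -/
def minSet {P : Type*} [PartialOrder P] (F : Set P) : Set P := {v | Minimal (· ∈ F) v}

/-- The signature of a chain in `E(P)`. -/
noncomputable def esgn {P : Type*} [PartialOrder P] (K : Set (P → ℤ)) (v : P) : ℤ :=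
  if h : ∃ f ∈ K, Minimal (· ∈ zsupp f) v then h.choose v else 0

/-- The enriched transfer map. -/
noncomputable def ePhi {P : Type*} [PartialOrder P] (f : P → ℤ) : P → ℝ :=
  fun v => if Minimal (· ∈ zsupp f) v then (f v : ℝ) else 0

/-- The simplex `T^e_K` attached to a chain `K` in `E(P)`. -/
noncomputable def Tsimp {P : Type*} [PartialOrder P] (K : Set (P → ℤ)) : Set (P → ℝ) :=
  convexHull ℝ (ePhi '' K)

/-- Indicator of the set of minimal elements of `F`. -/
noncomputable def chiMin {P : Type*} [PartialOrder P] (F : Set P) : P → ℝ :=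
  fun v => if Minimal (· ∈ F) v then 1 else 0

/-- The simplex `T_C` attached to a chain `C` of order filters. -/
noncomputable def TCsimp {P : Type*} [PartialOrder P] (C : Set (Set P)) : Set (P → ℝ) :=
  convexHull ℝ (chiMin '' C)

/-- The sign-change map `R_φ`. -/
def Rmap {P : Type*} (φ : P → ℤ) (g : P → ℝ) : P → ℝ :=
  fun v => if φ v = -1 then -g v else g v

/-- The orthant-type region `V_φ`. -/
def Vset {P : Type*} (φ : P → ℤ) : Set (P → ℝ) :=
  {g | ∀ v, (φ v = 1 → 0 ≤ g v) ∧ (φ v = 0 → g v = 0) ∧ (φ v = -1 → g v ≤ 0)}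

/-- The set `eA(P)` of `±1`-indicator vectors of antichains, inside `ℝ^P`. -/
def eAset (P : Type*) [PartialOrder P] : Set (P → ℝ) :=
  {g | (∀ v, g v = 1 ∨ g v = 0 ∨ g v = -1) ∧ IsAntichain (· ≤ ·) {v | g v ≠ 0}}

/-- The enriched chain polytope `eC(P)`. -/
noncomputable def eChainPolytope (P : Type*) [PartialOrder P] : Set (P → ℝ) :=
  convexHull ℝ (eAset P)

/-- The chain polytope `C(P)`. -/
noncomputable def chainPolytope (P : Type*) [PartialOrder P] : Set (P → ℝ) :=
  convexHull ℝ {g : P → ℝ | ∃ A : Set P, IsAntichain (· ≤ ·) A ∧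
    g = fun v => if v ∈ A then 1 else 0}

/-- A chain of order filters of `P`. -/
def IsFilterChain {P : Type*} [PartialOrder P] (C : Set (Set P)) : Prop :=
  (∀ F ∈ C, IsOrderFilter F) ∧ IsChain (· ⊆ ·) C

/-- A maximal chain of order filters of `P`. -/
def IsMaxFilterChain {P : Type*} [PartialOrder P] (C : Set (Set P)) : Prop :=
  IsFilterChain C ∧ ∀ D, IsFilterChain D → C ⊆ D → C = D

/-- The element of `E(P)` with support `F` and values `φ` on the minimal elements of `F`. -/
noncomputable def signedFilter {P : Type*} [PartialOrder P] (φ : P → ℤ) (F : Set P) : P → ℤ :=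
  fun v => if v ∈ F then (if Minimal (· ∈ F) v then φ v else 1) else 0

section

variable {P : Type*} [PartialOrder P]

lemma signedFilter_of_minimal (φ : P → ℤ) {F : Set P} {v : P} (hv : Minimal (· ∈ F) v) :
    signedFilter φ F v = φ v := by
  have : v ∈ F := hv.prop
  simp [signedFilter, hv, this]

lemma zsupp_signedFilter {φ : P → ℤ} (hφ : ∀ v, φ v = 1 ∨ φ v = -1) (F : Set P) :
    zsupp (signedFilter φ F) = F := by
  ext v
  have h0 : φ v ≠ 0 := by have := hφ v; omega
  change signedFilter φ F v ≠ 0 ↔ v ∈ F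
  simp only [signedFilter]
  split_ifs with h <;> simp [h, h0]

lemma isEF_signedFilter {φ : P → ℤ} (hφ : ∀ v, φ v = 1 ∨ φ v = -1) {F : Set P}
    (hF : IsOrderFilter F) : IsEF (signedFilter φ F) := by
  refine ⟨fun v => ?_, ?_, ?_⟩
  · have := hφ v
    simp only [signedFilter]
    split_ifs <;> omega
  · rwa [zsupp_signedFilter hφ]
  · rw [zsupp_signedFilter hφ]
    intro v hv hm
    simp [signedFilter, hv, hm]

lemma egt_signedFilter {φ : P → ℤ} (hφ : ∀ v, φ v = 1 ∨ φ v = -1) {F G : Set P}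
    (h : G ⊂ F) : egt (signedFilter φ F) (signedFilter φ G) := by
  have key : ∀ v ∈ G, Minimal (· ∈ F) v → Minimal (· ∈ G) v := fun v hv hm =>
    ⟨hv, fun y hy hyv => hm.2 (h.1 hy) hyv⟩
  simp only [egt, zsupp_signedFilter hφ]
  refine ⟨h, fun v hv => ?_, fun v hv hm => ?_⟩
  · by_cases hm : Minimal (· ∈ F) v
    · rw [signedFilter_of_minimal φ hm, signedFilter_of_minimal φ (key v hv hm)]
    · have hF : v ∈ F := h.1 hv
      have := hφ v
      simp only [signedFilter, hv, hF, hm, if_true, if_false]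
      split_ifs <;> omega
  · rw [signedFilter_of_minimal φ hm, signedFilter_of_minimal φ (key v hv hm)]

lemma isEChain_signedFilter_image {φ : P → ℤ} (hφ : ∀ v, φ v = 1 ∨ φ v = -1)
    {C : Set (Set P)} (hC : IsFilterChain C) : IsEChain (signedFilter φ '' C) := by
  refine ⟨?_, ?_⟩
  · rintro _ ⟨F, hF, rfl⟩
    exact isEF_signedFilter hφ (hC.1 F hF)
  · rintro _ ⟨F, hF, rfl⟩ _ ⟨G, hG, rfl⟩ hne
    have hFG : F ≠ G := fun h => hne (by rw [h])
    rcases hC.2 hF hG hFG with h | h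
    · exact .inr (.inr (egt_signedFilter hφ (h.ssubset_of_ne hFG)))
    · exact .inl (.inr (egt_signedFilter hφ (h.ssubset_of_ne hFG.symm)))

lemma zsupp_image_signedFilter_image {φ : P → ℤ} (hφ : ∀ v, φ v = 1 ∨ φ v = -1)
    (C : Set (Set P)) : zsupp '' (signedFilter φ '' C) = C := by
  simp [Set.image_image, zsupp_signedFilter hφ]

lemma IsEChain.egt_or_egt {K : Set (P → ℤ)} (hK : IsEChain K) {f g : P → ℤ}
    (hf : f ∈ K) (hg : g ∈ K) (hne : f ≠ g) : egt f g ∨ egt g f := by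
  rcases hK.2 hf hg hne with (h | h) | (h | h)
  exacts [absurd h hne, .inl h, absurd h.symm hne, .inr h]

lemma IsEChain.eq_of_zsupp_eq {K : Set (P → ℤ)} (hK : IsEChain K) {f g : P → ℤ}
    (hf : f ∈ K) (hg : g ∈ K) (h : zsupp f = zsupp g) : f = g := by
  by_contra hne
  rcases hK.egt_or_egt hf hg hne with h' | h'
  exacts [h'.1.ne h.symm, h'.1.ne h]

lemma IsEChain.isFilterChain_zsupp_image {K : Set (P → ℤ)} (hK : IsEChain K) :
    IsFilterChain (zsupp '' K) := by
  refine ⟨?_, ?_⟩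
  · rintro _ ⟨f, hf, rfl⟩
    exact (hK.1 f hf).2.1
  · rintro _ ⟨f, hf, rfl⟩ _ ⟨g, hg, rfl⟩ hne
    rcases hK.egt_or_egt hf hg (fun h => hne (by rw [h])) with h | h
    exacts [.inr h.1.1, .inl h.1.1]

lemma IsEChain.esgn_eq {K : Set (P → ℤ)} (hK : IsEChain K) {f : P → ℤ} (hf : f ∈ K) {v : P}
    (hv : Minimal (· ∈ zsupp f) v) : esgn K v = f v := by
  have h : ∃ f ∈ K, Minimal (· ∈ zsupp f) v := ⟨f, hf, hv⟩
  rw [esgn, dif_pos h]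
  obtain ⟨hg, hgv⟩ := h.choose_spec
  by_cases hne : h.choose = f
  · rw [hne]
  · rcases hK.egt_or_egt hg hf hne with h' | h'
    · exact h'.2.2 v hv.prop hgv
    · exact (h'.2.2 v hgv.prop hv).symm

lemma IsEChain.signedFilter_zsupp_eq {K : Set (P → ℤ)} (hK : IsEChain K) {φ : P → ℤ}
    {f : P → ℤ} (hf : f ∈ K) (hφ : ∀ v, Minimal (· ∈ zsupp f) v → φ v = f v) :
    signedFilter φ (zsupp f) = f := by
  funext v
  by_cases hv : v ∈ zsupp f
  · by_cases hm : Minimal (· ∈ zsupp f) v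
    · rw [signedFilter_of_minimal φ hm, hφ v hm]
    · simp [signedFilter, hv, hm, (hK.1 f hf).2.2 v hv hm]
  · rw [signedFilter, if_neg hv]
    exact (not_not.mp hv).symm

lemma IsEChain.eq_signedFilter_image {K : Set (P → ℤ)} (hK : IsEChain K) :
    signedFilter (esgn K) '' (zsupp '' K) = K := by
  rw [Set.image_image]
  refine (Set.image_congr fun f hf => ?_).trans (Set.image_id' K)
  exact hK.signedFilter_zsupp_eq hf fun v hv => hK.esgn_eq hf hv

lemma IsEChain.exists_signs {K : Set (P → ℤ)} (hK : IsEChain K) :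
    ∃ φ : P → ℤ, (∀ v, φ v = 1 ∨ φ v = -1) ∧ signedFilter φ '' (zsupp '' K) = K := by
  refine ⟨fun v => if esgn K v = -1 then -1 else 1, fun v => ?_, ?_⟩
  · dsimp only
    split_ifs <;> simp
  · rw [Set.image_image]
    refine (Set.image_congr fun f hf => ?_).trans (Set.image_id' K)
    refine hK.signedFilter_zsupp_eq hf fun v hv => ?_
    have h0 : f v ≠ 0 := hv.prop
    have h1 := (hK.1 f hf).1 v
    simp only [hK.esgn_eq hf hv]
    split_ifs <;> omega

lemma IsMaxFilterChain.mem_of_comparable {C : Set (Set P)} (hC : IsMaxFilterChain C) {F : Set P}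
    (hF : IsOrderFilter F) (h : ∀ G ∈ C, F ⊆ G ∨ G ⊆ F) : F ∈ C := by
  rw [hC.2 (insert F C) ⟨?_, hC.1.2.insert fun G hG _ => h G hG⟩ (Set.subset_insert F C)]
  · exact Set.mem_insert F C
  · rintro G (rfl | hG)
    exacts [hF, hC.1.1 G hG]

/-- Every element of the poset is minimal in some member of a maximal chain of filters. -/
lemma IsMaxFilterChain.exists_minimal {C : Set (Set P)} (hC : IsMaxFilterChain C) (v : P) :
    ∃ F ∈ C, Minimal (· ∈ F) v := by
  set F : Set P := {x | ∀ A ∈ C, v ∈ A → x ∈ A} with hF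
  set H : Set P := {x | v ≤ x ∨ ∃ A ∈ C, v ∉ A ∧ x ∈ A} with hH
  have sub : ∀ A ∈ C, ∀ B ∈ C, v ∈ B → v ∉ A → A ⊆ B := by
    intro A hA B hB hvB hvA
    rcases hC.1.2.total hA hB with h | h
    exacts [h, absurd (h hvB) hvA]
  have hFC : F ∈ C := by
    refine hC.mem_of_comparable (fun x y hx hxy A hA hv => hC.1.1 A hA (hx A hA hv) hxy)
      fun A hA => ?_
    by_cases hv : v ∈ A
    · exact .inl fun x hx => hx A hA hv
    · exact .inr fun x hx B hB hvB => sub A hA B hB hvB hv hx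
  have hHC : H ∈ C := by
    refine hC.mem_of_comparable ?_ fun A hA => ?_
    · rintro x y (hx | ⟨A, hA, hv, hx⟩) hxy
      exacts [.inl (hx.trans hxy), .inr ⟨A, hA, hv, hC.1.1 A hA hx hxy⟩]
    · by_cases hv : v ∈ A
      · left
        rintro x (hx | ⟨B, hB, hvB, hx⟩)
        exacts [hC.1.1 A hA hv hx, sub B hB A hA hv hvB hx]
      · exact .inr fun x hx => .inr ⟨A, hA, hv, hx⟩
  refine ⟨F, hFC, fun A _ hv => hv, fun w hw hwv => ?_⟩
  rcases hw H hHC (.inl le_rfl) with h | ⟨A, hA, hv, hwA⟩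
  exacts [h, absurd (hC.1.1 A hA hwA hwv) hv]

lemma IsMaxEChain.isMaxFilterChain_zsupp_image {K : Set (P → ℤ)} (hK : IsMaxEChain K) :
    IsMaxFilterChain (zsupp '' K) := by
  refine ⟨hK.1.isFilterChain_zsupp_image, fun D hD hKD => ?_⟩
  obtain ⟨φ, hφ, hKφ⟩ := hK.1.exists_signs
  have hsub := Set.image_mono (f := signedFilter φ) hKD
  rw [hKφ] at hsub
  rw [hK.2 _ (isEChain_signedFilter_image hφ hD) hsub, zsupp_image_signedFilter_image hφ]

lemma IsMaxEChain.esgn_eq_one_or {K : Set (P → ℤ)} (hK : IsMaxEChain K) (v : P) :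
    esgn K v = 1 ∨ esgn K v = -1 := by
  obtain ⟨_, ⟨f, hf, rfl⟩, hv⟩ := hK.isMaxFilterChain_zsupp_image.exists_minimal v
  have h0 : f v ≠ 0 := hv.prop
  have h1 := (hK.1.1 f hf).1 v
  rw [hK.1.esgn_eq hf hv]
  omega

lemma IsMaxFilterChain.isMaxEChain_signedFilter_image {C : Set (Set P)}
    (hC : IsMaxFilterChain C) {φ : P → ℤ} (hφ : ∀ v, φ v = 1 ∨ φ v = -1) :
    IsMaxEChain (signedFilter φ '' C) := by
  refine ⟨isEChain_signedFilter_image hφ hC.1, fun L hL hsub => hsub.antisymm fun f hf => ?_⟩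
  have hCL := Set.image_mono (f := zsupp) hsub
  rw [zsupp_image_signedFilter_image hφ] at hCL
  have hfC : zsupp f ∈ C := by
    rw [hC.2 _ hL.isFilterChain_zsupp_image hCL]
    exact Set.mem_image_of_mem zsupp hf
  have hmem := Set.mem_image_of_mem (signedFilter φ) hfC
  rwa [hL.eq_of_zsupp_eq hf (hsub hmem) (zsupp_signedFilter hφ _).symm]

lemma IsMaxFilterChain.esgn_signedFilter_image {C : Set (Set P)} (hC : IsMaxFilterChain C)
    {φ : P → ℤ} (hφ : ∀ v, φ v = 1 ∨ φ v = -1) : esgn (signedFilter φ '' C) = φ := by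
  funext v
  obtain ⟨F, hF, hv⟩ := hC.exists_minimal v
  rw [(isEChain_signedFilter_image hφ hC.1).esgn_eq (Set.mem_image_of_mem _ hF)
    (by rwa [zsupp_signedFilter hφ]), signedFilter_of_minimal φ hv]

end

theorem stmt9 {P : Type*} [Fintype P] [PartialOrder P] :
    Set.BijOn (fun K : Set (P → ℤ) => (zsupp '' K, esgn K))
      {K : Set (P → ℤ) | IsMaxEChain K}
      {p : Set (Set P) × (P → ℤ) |
        IsMaxFilterChain p.1 ∧ ∀ v, p.2 v = 1 ∨ p.2 v = -1} := by
  refine ⟨fun K hK => ⟨IsMaxEChain.isMaxFilterChain_zsupp_image hK,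
    IsMaxEChain.esgn_eq_one_or hK⟩, fun K hK L hL h => ?_, ?_⟩
  · obtain ⟨hs, he⟩ := Prod.mk.inj h
    rw [← hK.1.eq_signedFilter_image, ← hL.1.eq_signedFilter_image, hs, he]
  · rintro ⟨C, φ⟩ ⟨hC, hφ⟩
    exact ⟨signedFilter φ '' C, hC.isMaxEChain_signedFilter_image hφ,
      Prod.ext (zsupp_image_signedFilter_image hφ C) (hC.esgn_signedFilter_image hφ)⟩
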